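/- Let P = (V, ρ) be a quasi-metric space on a four-element set V that has no universal line and has fewer than four distinct lines. Then the betweenness B(ρ) is isomorphic to B(Q(4)) = {(p,q,r), (r,p,q), (s,q,p), (q,p,s)}. -/

import Mathlib

/-- A quasi-metric on `V`: nonnegative, vanishing exactly on the diagonal,
and satisfying the (directed) triangle inequality. -/
def IsQuasiMetric {V : Type*} (d : V → V → ℝ) : Prop :=
  (∀ x y, 0 ≤ d x y) ∧ (∀ x y, d x y = 0 ↔ x = y) ∧ (∀ x y z, d x z ≤ d x y + d y z)

/-- Betweenness: `y` lies between `x` and `z` (all three pairwise distinct). -/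
def BtwQM {V : Type*} (d : V → V → ℝ) (x y z : V) : Prop :=
  x ≠ y ∧ y ≠ z ∧ x ≠ z ∧ d x z = d x y + d y z

/-- The line through `x` and `y`. -/
def lineQM {V : Type*} (d : V → V → ℝ) (x y : V) : Set V :=
  {z | d z y = d z x + d x y ∨ d x y = d x z + d z y ∨ d x z = d x y + d y z}

/-- The set of all lines of the space. -/
def linesQM {V : Type*} (d : V → V → ℝ) : Set (Set V) :=
  {ℓ | ∃ x y, x ≠ y ∧ ℓ = lineQM d x y}

/-- The four points of the space `Q(4)`. -/
inductive P4 : Type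
  | p | s | q | r
deriving DecidableEq

open P4

/-- The quasi-metric of the space `Q(4)`. -/
def dQ4 : P4 → P4 → ℝ
  | p, p => 0 | p, s => 1 | p, q => 1 | p, r => 3
  | s, p => 3 | s, s => 0 | s, q => 2 | s, r => 3
  | q, p => 1 | q, s => 2 | q, q => 0 | q, r => 2
  | r, p => 1 | r, s => 1 | r, q => 2 | r, r => 0

/-- The betweenness of `Q(4)`. -/
def BQ4 : Set (P4 × P4 × P4) := {(p, q, r), (r, p, q), (s, q, p), (q, p, s)}

section Betweenness

variable {V : Type*} {d : V → V → ℝ}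

theorem IsQuasiMetric.pos (hd : IsQuasiMetric d) {x y : V} (h : x ≠ y) : 0 < d x y :=
  lt_of_le_of_ne (hd.1 x y) fun h' => h ((hd.2.1 x y).1 h'.symm)

theorem BtwQM.not_swap_right (hd : IsQuasiMetric d) {x y z : V} (h : BtwQM d x y z) :
    ¬ BtwQM d x z y := by
  intro h'
  have h₁ := hd.pos h.2.1
  have h₂ := hd.pos h'.2.1
  linarith [h.2.2.2, h'.2.2.2]

theorem BtwQM.not_swap_left (hd : IsQuasiMetric d) {x y z : V} (h : BtwQM d x y z) :
    ¬ BtwQM d y x z := by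
  intro h'
  have h₁ := hd.pos h.1
  have h₂ := hd.pos h'.1
  linarith [h.2.2.2, h'.2.2.2]

theorem left_mem_lineQM (hd : IsQuasiMetric d) (x y : V) : x ∈ lineQM d x y := by
  have h := (hd.2.1 x x).2 rfl
  simp [lineQM, h]

theorem right_mem_lineQM (hd : IsQuasiMetric d) (x y : V) : y ∈ lineQM d x y := by
  have h := (hd.2.1 y y).2 rfl
  simp [lineQM, h]

theorem mem_lineQM_iff {x y z : V} (hxy : x ≠ y) (hxz : x ≠ z) (hyz : y ≠ z) :
    z ∈ lineQM d x y ↔ BtwQM d z x y ∨ BtwQM d x z y ∨ BtwQM d x y z := by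
  simp [lineQM, BtwQM, hxy, hxz, hyz, hxz.symm, hyz.symm, add_comm]

theorem lineQM_mem_linesQM {x y : V} (h : x ≠ y) : lineQM d x y ∈ linesQM d :=
  ⟨x, y, h, rfl⟩

/-- In a triple `a, b, c` whose lines `bc` and `cb` contain `a`, at most one of the lines
`ab`, `ba`, `ac`, `ca` misses the third point. -/
theorem at_most_one_missing (hd : IsQuasiMetric d) {a b c : V} (hab : a ≠ b) (hac : a ≠ c)
    (hbc : b ≠ c) (h₁ : a ∈ lineQM d b c) (h₂ : a ∈ lineQM d c b) :
    (c ∈ lineQM d a b ∨ c ∈ lineQM d b a) ∧ (b ∈ lineQM d a c ∨ b ∈ lineQM d c a) ∧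
    (c ∈ lineQM d a b ∨ b ∈ lineQM d a c) ∧ (c ∈ lineQM d a b ∨ b ∈ lineQM d c a) ∧
    (c ∈ lineQM d b a ∨ b ∈ lineQM d a c) ∧ (c ∈ lineQM d b a ∨ b ∈ lineQM d c a) := by
  have l₁ := BtwQM.not_swap_left hd (x := a) (y := b) (z := c)
  have l₂ := BtwQM.not_swap_left hd (x := b) (y := c) (z := a)
  have l₃ := BtwQM.not_swap_left hd (x := c) (y := a) (z := b)
  have r₁ := BtwQM.not_swap_right hd (x := a) (y := b) (z := c)
  have r₂ := BtwQM.not_swap_right hd (x := b) (y := c) (z := a)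
  have r₃ := BtwQM.not_swap_right hd (x := c) (y := a) (z := b)
  simp only [mem_lineQM_iff, hab, hab.symm, hac, hac.symm, hbc, hbc.symm, ne_eq,
    not_false_eq_true] at *
  grind

/-- A triple `a, b, c` whose lines `ac`, `ca` contain the third point, while `ab` does not,
has exactly the betweennesses `cba` and `bac`. -/
theorem btwQM_of_missing (hd : IsQuasiMetric d) {a b c : V} (hab : a ≠ b) (hac : a ≠ c)
    (hbc : b ≠ c) (h₁ : b ∈ lineQM d a c) (h₂ : b ∈ lineQM d c a) (h₃ : c ∉ lineQM d a b) :
    BtwQM d c b a ∧ BtwQM d b a c ∧ ¬ BtwQM d a b c ∧ ¬ BtwQM d a c b ∧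
      ¬ BtwQM d b c a ∧ ¬ BtwQM d c a b := by
  have l₁ := BtwQM.not_swap_left hd (x := a) (y := b) (z := c)
  have l₂ := BtwQM.not_swap_left hd (x := b) (y := c) (z := a)
  have l₃ := BtwQM.not_swap_left hd (x := c) (y := a) (z := b)
  have r₁ := BtwQM.not_swap_right hd (x := a) (y := b) (z := c)
  have r₂ := BtwQM.not_swap_right hd (x := b) (y := c) (z := a)
  have r₃ := BtwQM.not_swap_right hd (x := c) (y := a) (z := b)
  simp only [mem_lineQM_iff, hab, hac, hac.symm, hbc, hbc.symm, ne_eq,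
    not_false_eq_true] at *
  grind

theorem eq_of_mem_linesQM [Finite V] (hfew : (linesQM d).ncard < 4) {L₁ L₂ L₃ L₄ : Set V}
    (h₁ : L₁ ∈ linesQM d) (h₂ : L₂ ∈ linesQM d) (h₃ : L₃ ∈ linesQM d) (h₄ : L₄ ∈ linesQM d) :
    L₁ = L₂ ∨ L₁ = L₃ ∨ L₁ = L₄ ∨ L₂ = L₃ ∨ L₂ = L₄ ∨ L₃ = L₄ := by
  by_contra! h
  obtain ⟨h₁₂, h₁₃, h₁₄, h₂₃, h₂₄, h₃₄⟩ := h
  have hsub : ({L₁, L₂, L₃, L₄} : Set (Set V)) ⊆ linesQM d := by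
    rintro L (rfl | rfl | rfl | rfl) <;> assumption
  have hle := Set.ncard_le_ncard hsub (Set.toFinite _)
  rw [Set.ncard_insert_of_notMem (by simp [*]), Set.ncard_insert_of_notMem (by simp [*]),
    Set.ncard_pair h₃₄] at hle
  omega

/-- If `{c, e}` is a line of a four-point space, every line containing one of the two remaining
points `a` contains the other one. -/
theorem mem_of_pair_mem_linesQM [Finite V] (hd : IsQuasiMetric d)
    (hfew : (linesQM d).ncard < 4) (hnouniv : ∀ x y : V, x ≠ y → lineQM d x y ≠ Set.univ)
    {a b c e : V} (hab : a ≠ b) (hac : a ≠ c) (hae : a ≠ e) (hbc : b ≠ c) (hbe : b ≠ e)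
    (hcover : ∀ x, x = a ∨ x = b ∨ x = c ∨ x = e)
    (hpair : ({c, e} : Set V) ∈ linesQM d) {M : Set V} (hM : M ∈ linesQM d)
    (haM : a ∈ M) : b ∈ M := by
  by_contra hb
  have b₁ := left_mem_lineQM hd b c
  have b₂ := left_mem_lineQM hd b e
  have b₃ := right_mem_lineQM hd a b
  have hbp : b ∉ ({c, e} : Set V) := by simp [hbc, hbe]
  have hap : a ∉ ({c, e} : Set V) := by simp [hac, hae]
  have hKL : lineQM d b c = lineQM d b e := by
    have := eq_of_mem_linesQM hfew hpair hM (lineQM_mem_linesQM hbc) (lineQM_mem_linesQM hbe)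
    grind
  have hNL : lineQM d a b = lineQM d b e := by
    have := eq_of_mem_linesQM hfew hpair hM (lineQM_mem_linesQM hab) (lineQM_mem_linesQM hbe)
    grind
  refine hnouniv b e hbe (Set.eq_univ_of_forall fun x => ?_)
  rcases hcover x with rfl | rfl | rfl | rfl
  · exact hNL ▸ left_mem_lineQM hd x b
  · exact b₂
  · exact hKL ▸ right_mem_lineQM hd b x
  · exact right_mem_lineQM hd b x

theorem notMem_lineQM_of_mem (hd : IsQuasiMetric d)
    (hnouniv : ∀ x y : V, x ≠ y → lineQM d x y ≠ Set.univ) {x y z w : V} (hxy : x ≠ y)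
    (hcover : ∀ v, v = x ∨ v = y ∨ v = z ∨ v = w) (hz : z ∈ lineQM d x y) :
    w ∉ lineQM d x y := by
  intro hw
  refine hnouniv x y hxy (Set.eq_univ_of_forall fun v => ?_)
  rcases hcover v with rfl | rfl | rfl | rfl
  · exact left_mem_lineQM hd v y
  · exact right_mem_lineQM hd x v
  · exact hz
  · exact hw

theorem not_btwQM_of_notMem {x y z : V} (h₁ : z ∉ lineQM d x y) (h₂ : z ∉ lineQM d y x) :
    ¬ BtwQM d x y z ∧ ¬ BtwQM d x z y ∧ ¬ BtwQM d y x z ∧ ¬ BtwQM d y z x ∧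
      ¬ BtwQM d z x y ∧ ¬ BtwQM d z y x := by
  simp only [lineQM, Set.mem_ofPred_eq] at h₁ h₂
  unfold BtwQM
  grind

/-- A labelling of the four points whose betweennesses are those of `Q(4)` is an isomorphism. -/
theorem exists_equiv_of_labelling {P S Q R : V} (hPS : P ≠ S) (hPQ : P ≠ Q) (hPR : P ≠ R)
    (hSQ : S ≠ Q) (hSR : S ≠ R) (hQR : Q ≠ R) (hcover : ∀ v, v = P ∨ v = S ∨ v = Q ∨ v = R)
    (hB : ∀ x y z, BtwQM d x y z ↔ (x = P ∧ y = Q ∧ z = R) ∨ (x = R ∧ y = P ∧ z = Q) ∨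
      (x = S ∧ y = Q ∧ z = P) ∨ (x = Q ∧ y = P ∧ z = S)) :
    ∃ f : V ≃ P4, ∀ x y z : V, BtwQM d x y z ↔ (f x, f y, f z) ∈ BQ4 := by
  let g : P4 → V := fun t => match t with | p => P | s => S | q => Q | r => R
  have hg : Function.Bijective g := by
    constructor
    · intro t u h
      cases t <;> cases u <;> simp_all [g, eq_comm]
    · intro v
      rcases hcover v with rfl | rfl | rfl | rfl
      exacts [⟨p, rfl⟩, ⟨s, rfl⟩, ⟨q, rfl⟩, ⟨r, rfl⟩]
  refine ⟨(Equiv.ofBijective g hg).symm, fun x y z => ?_⟩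
  have key (v : V) (t : P4) : (Equiv.ofBijective g hg).symm v = t ↔ v = g t :=
    Equiv.symm_apply_eq _
  rw [hB]
  simp only [BQ4, Set.mem_insert_iff, Set.mem_singleton_iff, Prod.mk.injEq, key, g]

/-- If every line contains both or neither of `a` and `b`, the line `ab` misses `c` and the line
`ba` misses `e`, then the betweenness is that of `Q(4)`. -/
theorem exists_equiv_of_missing (hd : IsQuasiMetric d) {a b c e : V} (hab : a ≠ b) (hac : a ≠ c)
    (hae : a ≠ e) (hbc : b ≠ c) (hbe : b ≠ e) (hce : c ≠ e)
    (hcover : ∀ x, x = a ∨ x = b ∨ x = c ∨ x = e)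
    (ha : ∀ x y, x ≠ y → b ∈ lineQM d x y → a ∈ lineQM d x y)
    (hb : ∀ x y, x ≠ y → a ∈ lineQM d x y → b ∈ lineQM d x y)
    (hnouniv : ∀ x y : V, x ≠ y → lineQM d x y ≠ Set.univ)
    (hc : c ∉ lineQM d a b) (he : e ∉ lineQM d b a) :
    ∃ f : V ≃ P4, ∀ x y z : V, BtwQM d x y z ↔ (f x, f y, f z) ∈ BQ4 := by
  have h₁ := hb a c hac (left_mem_lineQM hd a c)
  have h₂ := hb c a hac.symm (right_mem_lineQM hd c a)
  have h₃ := ha b c hbc (left_mem_lineQM hd b c)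
  have h₄ := ha c b hbc.symm (right_mem_lineQM hd c b)
  have h₅ := ha b e hbe (left_mem_lineQM hd b e)
  have h₆ := ha e b hbe.symm (right_mem_lineQM hd e b)
  have ace := not_btwQM_of_notMem
    (notMem_lineQM_of_mem hd hnouniv hac
      (fun v => by rcases hcover v with h | h | h | h <;> simp [h]) h₁ : e ∉ lineQM d a c)
    (notMem_lineQM_of_mem hd hnouniv hac.symm
      (fun v => by rcases hcover v with h | h | h | h <;> simp [h]) h₂)
  have bce := not_btwQM_of_notMem
    (notMem_lineQM_of_mem hd hnouniv hbc
      (fun v => by rcases hcover v with h | h | h | h <;> simp [h]) h₃ : e ∉ lineQM d b c)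
    (notMem_lineQM_of_mem hd hnouniv hbc.symm
      (fun v => by rcases hcover v with h | h | h | h <;> simp [h]) h₄)
  have abc := btwQM_of_missing hd hab hac hbc h₁ h₂ hc
  have abe := btwQM_of_missing hd hab.symm hbe hae h₅ h₆ he
  have hne {x y z : V} (h : BtwQM d x y z) : x ≠ y ∧ y ≠ z ∧ x ≠ z := ⟨h.1, h.2.1, h.2.2.1⟩
  refine exists_equiv_of_labelling (P := a) (S := c) (Q := b) (R := e) hac hab hae hbc.symm hce
    hbe (fun v => by rcases hcover v with h | h | h | h <;> simp [h]) fun x y z => ?_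
  rcases hcover x with rfl | rfl | rfl | rfl <;> rcases hcover y with rfl | rfl | rfl | rfl <;>
    rcases hcover z with rfl | rfl | rfl | rfl <;> grind

theorem exists_equiv_of_pair_mem_linesQM [Finite V] (hd : IsQuasiMetric d)
    (hfew : (linesQM d).ncard < 4) (hnouniv : ∀ x y : V, x ≠ y → lineQM d x y ≠ Set.univ)
    {a b c e : V} (hab : a ≠ b) (hac : a ≠ c) (hae : a ≠ e) (hbc : b ≠ c) (hbe : b ≠ e)
    (hce : c ≠ e) (hcover : ∀ x, x = a ∨ x = b ∨ x = c ∨ x = e)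
    (hpair : ({c, e} : Set V) ∈ linesQM d) :
    ∃ f : V ≃ P4, ∀ x y z : V, BtwQM d x y z ↔ (f x, f y, f z) ∈ BQ4 := by
  have hb (x y : V) (h : x ≠ y) := mem_of_pair_mem_linesQM hd hfew hnouniv hab hac hae hbc hbe
    hcover hpair (lineQM_mem_linesQM h)
  have ha (x y : V) (h : x ≠ y) := mem_of_pair_mem_linesQM hd hfew hnouniv hab.symm hbc hbe hac
    hae (fun v => by rcases hcover v with h | h | h | h <;> simp [h]) hpair (lineQM_mem_linesQM h)
  have nab := notMem_lineQM_of_mem hd hnouniv hab hcover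
  have nba := notMem_lineQM_of_mem hd hnouniv hab.symm (z := c) (w := e)
    (fun v => by rcases hcover v with h | h | h | h <;> simp [h])
  have mem (v : V) (hav : a ≠ v) (hbv : b ≠ v) : v ∈ lineQM d a b ∨ v ∈ lineQM d b a := by
    by_contra! h
    have h₁ := btwQM_of_missing hd hab hav hbv (hb a v hav (left_mem_lineQM hd a v))
      (hb v a hav.symm (right_mem_lineQM hd v a)) h.1
    exact h.2 ((mem_lineQM_iff hab.symm hbv hav).2 (Or.inl h₁.1))
  have hc := mem c hac hbc
  have he := mem e hae hbe
  by_cases hcab : c ∈ lineQM d a b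
  · exact exists_equiv_of_missing hd hab.symm hbc hbe hac hae hce
      (fun v => by rcases hcover v with h | h | h | h <;> simp [h]) hb ha hnouniv (by tauto)
      (nab hcab)
  · exact exists_equiv_of_missing hd hab hac hae hbc hbe hce hcover ha hb hnouniv hcab
      (by tauto)

/-- In a four-point space without universal lines, every point is missed by some line. -/
theorem exists_lineQM_missing (hd : IsQuasiMetric d)
    (hnouniv : ∀ x y : V, x ≠ y → lineQM d x y ≠ Set.univ) {a b c e : V} (hab : a ≠ b)
    (hac : a ≠ c) (hae : a ≠ e) (hbc : b ≠ c) (hbe : b ≠ e) (hce : c ≠ e)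
    (hcover : ∀ x, x = a ∨ x = b ∨ x = c ∨ x = e) :
    ∃ x y, x ≠ y ∧ a ∉ lineQM d x y := by
  by_contra! h
  have n₁ := notMem_lineQM_of_mem hd hnouniv hab hcover
  have n₂ := notMem_lineQM_of_mem hd hnouniv hab.symm (z := c) (w := e)
    (fun v => by rcases hcover v with h | h | h | h <;> simp [h])
  have n₃ := notMem_lineQM_of_mem hd hnouniv hac (z := b) (w := e)
    (fun v => by rcases hcover v with h | h | h | h <;> simp [h])
  have n₄ := notMem_lineQM_of_mem hd hnouniv hac.symm (z := b) (w := e)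
    (fun v => by rcases hcover v with h | h | h | h <;> simp [h])
  have n₅ := notMem_lineQM_of_mem hd hnouniv hae (z := b) (w := c)
    (fun v => by rcases hcover v with h | h | h | h <;> simp [h])
  have n₆ := notMem_lineQM_of_mem hd hnouniv hae.symm (z := b) (w := c)
    (fun v => by rcases hcover v with h | h | h | h <;> simp [h])
  have abc := at_most_one_missing hd hab hac hbc (h b c hbc) (h c b hbc.symm)
  have abe := at_most_one_missing hd hab hae hbe (h b e hbe) (h e b hbe.symm)
  have ace := at_most_one_missing hd hac hae hce (h c e hce) (h e c hce.symm)
  grind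

end Betweenness

/-- every quasi-metric space on four points with no universal line
and fewer than four distinct lines has betweenness isomorphic to that of `Q(4)`. -/
theorem stmt_7 (V : Type) [Fintype V] (hV : Fintype.card V = 4)
    (ρ : V → V → ℝ) (hρ : IsQuasiMetric ρ)
    (hnouniv : ∀ x y : V, x ≠ y → lineQM ρ x y ≠ Set.univ)
    (hfew : (linesQM ρ).ncard < 4) :
    ∃ f : V ≃ P4, ∀ x y z : V,
      BtwQM ρ x y z ↔ (f x, f y, f z) ∈ BQ4 := by
  classical
  by_cases hpair : ∃ c e : V, c ≠ e ∧ ({c, e} : Set V) ∈ linesQM ρ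
  · obtain ⟨c, e, hce, hpair⟩ := hpair
    obtain ⟨a, b, hab, hs⟩ : ∃ a b, a ≠ b ∧ ({c, e}ᶜ : Finset V) = {a, b} := by
      rw [← Finset.card_eq_two, Finset.card_compl, hV, Finset.card_pair hce]
    have hs' (x : V) : (x ≠ c ∧ x ≠ e) ↔ (x = a ∨ x = b) := by
      simpa using Finset.ext_iff.1 hs x
    obtain ⟨hac, hae⟩ := (hs' a).2 (Or.inl rfl)
    obtain ⟨hbc, hbe⟩ := (hs' b).2 (Or.inr rfl)
    exact exists_equiv_of_pair_mem_linesQM hρ hfew hnouniv hab hac hae hbc hbe hce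
      (fun x => by have := hs' x; tauto) hpair
  · push Not at hpair
    exfalso
    have hcompl (a : V) : ({a}ᶜ : Set V) ∈ linesQM ρ := by
      obtain ⟨b, c, e, hbc, hbe, hce, hs⟩ : ∃ b c e, b ≠ c ∧ b ≠ e ∧ c ≠ e ∧
          ({a}ᶜ : Finset V) = {b, c, e} := by
        rw [← Finset.card_eq_three, Finset.card_compl, hV, Finset.card_singleton]
      have hs' (x : V) : x ≠ a ↔ (x = b ∨ x = c ∨ x = e) := by
        simpa using Finset.ext_iff.1 hs x
      obtain ⟨x, y, hxy, ha⟩ := exists_lineQM_missing hρ hnouniv (a := a)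
        ((hs' b).2 (by simp)).symm ((hs' c).2 (by simp)).symm ((hs' e).2 (by simp)).symm hbc
        hbe hce (fun x => by have := hs' x; tauto)
      refine ⟨x, y, hxy, ?_⟩
      have hx := left_mem_lineQM hρ x y
      have hy := right_mem_lineQM hρ x y
      by_contra hne
      obtain ⟨z, hza, hz⟩ : ∃ z, z ≠ a ∧ z ∉ lineQM ρ x y := by
        by_contra! h
        exact hne (Set.ext fun v => ⟨h v, fun hv hva => ha (hva ▸ hv)⟩)
      refine hpair x y hxy ⟨x, y, hxy, Set.ext fun v => ⟨?_, fun hv => ?_⟩⟩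
      · rintro (rfl | rfl) <;> assumption
      · have hsv := hs' v
        have hsx := hs' x
        have hsy := hs' y
        have hsz := hs' z
        change v = x ∨ v = y
        grind
    have hrange : Set.range (fun a : V => ({a}ᶜ : Set V)) ⊆ linesQM ρ := by
      rintro _ ⟨a, rfl⟩
      exact hcompl a
    have hinj : Function.Injective fun a : V => ({a}ᶜ : Set V) :=
      compl_injective.comp Set.singleton_injective
    have hle := Set.ncard_le_ncard hrange (Set.toFinite _)
    rw [← Set.image_univ, Set.ncard_image_of_injective _ hinj, Set.ncard_univ,
      Nat.card_eq_fintype_card, hV] at hle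
    omega
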